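/- arXiv:1505.07123 — 3 statements merged into one kernel-verified Lean document; each statement's English description precedes it below -/
import Mathlib

section
/- Let (E, 𝓛, ℬ) be a weakly left resolving labelled space with associated inverse semigroup S. Let α ∈ 𝓛^∞(E) and let {F_n}_{n≥0} be an admissible family for α. Then ξ = ⋃_{n=0}^∞ ⋃_{A ∈ F_n} ↑(α_{1,n}, A, α_{1,n}) is a filter in E(S). -/
universe u v w

attribute [local instance] Classical.propDecidable

/-- Elements of the semigroups `T` and `S` associated with a labelled space:
`none` plays the role of the zero element, and `some (α, A, β)` is a triple. -/
abbrev STrip (V : Type u) (L : Type w) := List L × Set V × List L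

/-- A labelled graph: a directed graph `(V, Ed, rng, src)` together with a labelling
map `lbl` on edges, over the alphabet `L`. -/
structure LabelledGraph (V : Type u) (Ed : Type v) (L : Type w) where
  src : Ed → V
  rng : Ed → V
  lbl : Ed → L

namespace LabelledGraph

variable {V : Type u} {Ed : Type v} {L : Type w} (G : LabelledGraph V Ed L)

/-- A (finite) path: a list of edges with matching ranges and sources. -/
def IsPath (p : List Ed) : Prop := p.Chain' (fun e f => G.rng e = G.src f)

/-- `α ∈ 𝓛*(E)`: the labels of finite paths, together with the empty word `[]`. -/
def IsWord (α : List L) : Prop := ∃ p : List Ed, G.IsPath p ∧ p.map G.lbl = α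

/-- The relative range `r(A, α)`, with `r(A, ω) = A` for the empty word. -/
def relRange (A : Set V) : List L → Set V
  | [] => A
  | a :: w =>
      {v | ∃ (p : List Ed) (h : p ≠ []), G.IsPath p ∧ p.map G.lbl = a :: w ∧
        G.src (p.head h) ∈ A ∧ G.rng (p.getLast h) = v}

/-- `r(α) = r(E⁰, α)`. -/
def range (α : List L) : Set V := G.relRange Set.univ α

/-- `ℬ_α = ℬ ∩ 𝒫(r(α))`. -/
def rFam (ℬ : Set (Set V)) (α : List L) : Set (Set V) := {A ∈ ℬ | A ⊆ G.range α}

/-- `ℬ` is accommodating for the labelled graph `G`: closed under relative ranges,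
finite intersections and unions, and contains `r(α)` for every nonempty word `α`. -/
def Accommodating (ℬ : Set (Set V)) : Prop :=
  (∀ A ∈ ℬ, ∀ α : List L, G.IsWord α → G.relRange A α ∈ ℬ) ∧
  (∀ A ∈ ℬ, ∀ B ∈ ℬ, A ∩ B ∈ ℬ) ∧
  (∀ A ∈ ℬ, ∀ B ∈ ℬ, A ∪ B ∈ ℬ) ∧
  (∀ α : List L, α ≠ [] → G.IsWord α → G.range α ∈ ℬ)

/-- The labelled space `(G, ℬ)` is weakly left resolving. -/
def WeaklyLeftResolving (ℬ : Set (Set V)) : Prop :=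
  ∀ A ∈ ℬ, ∀ B ∈ ℬ, ∀ α : List L, α ≠ [] →
    G.relRange (A ∩ B) α = G.relRange A α ∩ G.relRange B α

/-- `ℬ` is closed under relative complements. -/
def ClosedUnderRelComp (ℬ : Set (Set V)) : Prop :=
  ∀ A ∈ ℬ, ∀ B ∈ ℬ, A \ B ∈ ℬ

/-- Membership in the semigroup `T`: either the zero `none`, or a triple `(α, A, β)`
with `α, β ∈ 𝓛*(E)` and `A ∈ ℬ_α ∩ ℬ_β`. -/
def ValidT (ℬ : Set (Set V)) (t : Option (STrip V L)) : Prop :=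
  ∀ x ∈ t, G.IsWord x.1 ∧ G.IsWord x.2.2 ∧ x.2.1 ∈ G.rFam ℬ x.1 ∧ x.2.1 ∈ G.rFam ℬ x.2.2

/-- Membership in the inverse semigroup `S`: as in `T`, but triples with empty middle
set are identified with the zero, so nonzero elements have nonempty middle set. -/
def ValidS (ℬ : Set (Set V)) (t : Option (STrip V L)) : Prop :=
  G.ValidT ℬ t ∧ ∀ x ∈ t, x.2.1 ≠ (∅ : Set V)

/-- The product on `T`. -/
noncomputable def mulT : Option (STrip V L) → Option (STrip V L) → Option (STrip V L)
  | some (α, A, β), some (γ, B, δ) =>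
      if β <+: γ then
        some (α ++ γ.drop β.length, G.relRange A (γ.drop β.length) ∩ B, δ)
      else if γ <+: β then
        some (α, A ∩ G.relRange B (β.drop γ.length), δ ++ β.drop γ.length)
      else none
  | _, _ => none

/-- The product on `S`: the product of `T`, with triples having empty middle set
collapsed to the zero element. -/
noncomputable def mulS (s t : Option (STrip V L)) : Option (STrip V L) :=
  match G.mulT s t with
  | none => none
  | some (α, A, β) => if A = (∅ : Set V) then none else some (α, A, β)

/-- A nonzero idempotent `(α, A, α)` of `S`, represented as the pair `(α, A)`. -/
def ValidE (ℬ : Set (Set V)) (p : List L × Set V) : Prop :=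
  G.IsWord p.1 ∧ p.2 ∈ G.rFam ℬ p.1 ∧ p.2 ≠ (∅ : Set V)

/-- The natural order on nonzero idempotents of `S`:
`(α, A, α) ≤ (β, B, β)` iff `α = βγ` and `A ⊆ r(B, γ)`. -/
def esLe (p q : List L × Set V) : Prop :=
  ∃ γ : List L, p.1 = q.1 ++ γ ∧ p.2 ⊆ G.relRange q.2 γ

/-- `p ∧ q ≠ 0` for nonzero idempotents `p`, `q` of `S`. -/
def meetNeZero (p q : List L × Set V) : Prop :=
  (∃ γ : List L, q.1 = p.1 ++ γ ∧ (G.relRange p.2 γ ∩ q.2).Nonempty) ∨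
  (∃ γ : List L, p.1 = q.1 ++ γ ∧ (p.2 ∩ G.relRange q.2 γ).Nonempty)

/-- A filter in the semilattice `E(S)`, identified with its set of (nonzero) elements:
nonempty, not containing `0`, upward closed and downward directed. -/
def IsFilterES (ℬ : Set (Set V)) (ξ : Set (List L × Set V)) : Prop :=
  ξ.Nonempty ∧ (∀ p ∈ ξ, G.ValidE ℬ p) ∧
  (∀ p ∈ ξ, ∀ q, G.ValidE ℬ q → G.esLe p q → q ∈ ξ) ∧
  (∀ p ∈ ξ, ∀ q ∈ ξ, ∃ z ∈ ξ, G.esLe z p ∧ G.esLe z q)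

/-- An ultrafilter in `E(S)`: a filter not properly contained in any filter. -/
def IsUltraES (ℬ : Set (Set V)) (ξ : Set (List L × Set V)) : Prop :=
  G.IsFilterES ℬ ξ ∧ ∀ η, G.IsFilterES ℬ η → ξ ⊆ η → ξ = η

/-- `Z` is a cover for `x` in `E(S)`: `Z ⊆ ↓x` and every nonzero `y ≤ x` meets some
element of `Z` nontrivially. -/
def IsCover (ℬ : Set (Set V)) (Z : Set (List L × Set V)) (x : List L × Set V) : Prop :=
  (∀ z ∈ Z, G.ValidE ℬ z ∧ G.esLe z x) ∧
  ∀ y, G.ValidE ℬ y → G.esLe y x → ∃ z ∈ Z, G.meetNeZero z y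

/-- A tight filter in `E(S)`: a filter meeting every finite cover of each of its
elements. -/
def IsTight (ℬ : Set (Set V)) (ξ : Set (List L × Set V)) : Prop :=
  G.IsFilterES ℬ ξ ∧
  ∀ x ∈ ξ, ∀ Z : Set (List L × Set V), Z.Finite → G.IsCover ℬ Z x → (Z ∩ ξ).Nonempty

/-- A filter in a family `𝒞` of subsets of `V` (e.g. `ℬ_α`), ordered by inclusion
with least element `∅`. -/
def IsFilterIn (𝒞 F : Set (Set V)) : Prop :=
  F.Nonempty ∧ F ⊆ 𝒞 ∧ (∅ : Set V) ∉ F ∧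
  (∀ A ∈ F, ∀ B ∈ 𝒞, A ⊆ B → B ∈ F) ∧
  (∀ A ∈ F, ∀ B ∈ F, ∃ C ∈ F, C ⊆ A ∧ C ⊆ B)

/-- An ultrafilter in a family `𝒞` of subsets of `V`. -/
def IsUltraIn (𝒞 F : Set (Set V)) : Prop :=
  IsFilterIn 𝒞 F ∧ ∀ F', IsFilterIn 𝒞 F' → F ⊆ F' → F = F'

/-- `α ∈ 𝓛^∞(E)`: labels of infinite paths. -/
def IsInfWord (α : ℕ → L) : Prop :=
  ∃ p : ℕ → Ed, (∀ n, G.rng (p n) = G.src (p (n + 1))) ∧ ∀ n, G.lbl (p n) = α n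

end LabelledGraph

/-- `α_{n+1, m}` (in the 1-indexed notation of the paper): the finite subword of the
infinite word `α` consisting of its letters at (0-indexed) positions `n, …, m-1`. -/
def LabelledGraph.seg {L : Type w} (α : ℕ → L) (n m : ℕ) : List L :=
  (List.range (m - n)).map fun i => α (n + i)

/-- `α_{1, n}`: the first `n` letters of the infinite word `α`. -/
def LabelledGraph.prefixN {L : Type w} (α : ℕ → L) (n : ℕ) : List L :=
  LabelledGraph.seg α 0 n

namespace LabelledGraph

variable {V : Type u} {Ed : Type v} {L : Type w} (G : LabelledGraph V Ed L)

/-- A family `{F n}` as in the paper: `F n` is a filter in `ℬ_{α_{1,n}}` for `n > 0`,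
and `F 0` is a filter in `ℬ` or empty. -/
def IsFam (ℬ : Set (Set V)) (α : ℕ → L) (F : ℕ → Set (Set V)) : Prop :=
  (∀ n, 0 < n → IsFilterIn (G.rFam ℬ (prefixN α n)) (F n)) ∧
  (F 0 = ∅ ∨ IsFilterIn (G.rFam ℬ (prefixN α 0)) (F 0))

/-- An admissible family for the infinite word `α`. -/
def Admissible (ℬ : Set (Set V)) (α : ℕ → L) (F : ℕ → Set (Set V)) : Prop :=
  G.IsFam ℬ α F ∧
  ∀ n, F n ⊆ {A ∈ G.rFam ℬ (prefixN α n) | G.relRange A [α n] ∈ F (n + 1)}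

/-- A complete family for the infinite word `α`. -/
def Complete (ℬ : Set (Set V)) (α : ℕ → L) (F : ℕ → Set (Set V)) : Prop :=
  G.IsFam ℬ α F ∧
  ∀ n, F n = {A ∈ G.rFam ℬ (prefixN α n) | G.relRange A [α n] ∈ F (n + 1)}

/-- The subset `⋃_{n} ⋃_{A ∈ F n} ↑(α_{1,n}, A, α_{1,n})` of `E(S)` determined by an
infinite word `α` and a family `{F n}`. -/
def filtOfFam (ℬ : Set (Set V)) (α : ℕ → L) (F : ℕ → Set (Set V)) :
    Set (List L × Set V) :=
  {q | G.ValidE ℬ q ∧ ∃ n, ∃ A ∈ F n, G.esLe (prefixN α n, A) q}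

/-- The prefix `α_{1,n}` of a finite-or-infinite word. -/
def wTake : List L ⊕ (ℕ → L) → ℕ → List L
  | Sum.inl w, n => w.take n
  | Sum.inr α, n => prefixN α n

/-- `n ≤ |α|` for a finite-or-infinite word `α`. -/
def wLe (n : ℕ) : List L ⊕ (ℕ → L) → Prop
  | Sum.inl w => n ≤ w.length
  | Sum.inr _ => True

/-- The finite-or-infinite word is a labelled path (`𝓛*(E) ∪ 𝓛^∞(E)`). -/
def wGood : List L ⊕ (ℕ → L) → Prop
  | Sum.inl w => G.IsWord w
  | Sum.inr α => G.IsInfWord α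

/-- `α` is a beginning of (or equal to) `β`, for finite-or-infinite words. -/
def wBeg : List L ⊕ (ℕ → L) → List L ⊕ (ℕ → L) → Prop
  | Sum.inl a, Sum.inl b => a <+: b
  | Sum.inl a, Sum.inr β => a = prefixN β a.length
  | Sum.inr α, Sum.inr β => α = β
  | Sum.inr _, Sum.inl _ => False

/-- The word associated with a filter `ξ` in `E(S)`: for a finite word `w`, `w`
appears in `ξ` and has the largest length; for an infinite word `α`, the words of
elements of `ξ` are beginnings of `α`, of unbounded length. -/
def HasWord (ξ : Set (List L × Set V)) : List L ⊕ (ℕ → L) → Prop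
  | Sum.inl w => (∃ A, (w, A) ∈ ξ) ∧ ∀ p ∈ ξ, p.1.length ≤ w.length
  | Sum.inr α => (∀ p ∈ ξ, ∃ n, p.1 = prefixN α n) ∧ ∀ n, ∃ p ∈ ξ, n ≤ p.1.length

end LabelledGraph
namespace LabelledGraph

theorem aux_mono {V : Type u} {Ed : Type v} {L : Type w} (G : LabelledGraph V Ed L)
    {A B : Set V} (h : A ⊆ B) (γ : List L) : G.relRange A γ ⊆ G.relRange B γ := by
  cases γ with
  | nil => exact h
  | cons a w =>
    rintro v ⟨p, hp, h1, h2, h3, h4⟩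
    exact ⟨p, hp, h1, h2, h h3, h4⟩

theorem aux_append {V : Type u} {Ed : Type v} {L : Type w} (G : LabelledGraph V Ed L)
    (A : Set V) (β γ : List L) :
    G.relRange (G.relRange A β) γ ⊆ G.relRange A (β ++ γ) := by
  cases γ with
  | nil => simp [relRange]
  | cons c w =>
    cases β with
    | nil => exact subset_rfl
    | cons b w' =>
      rintro v ⟨p, hp, h1, h2, ⟨q, hq, k1, k2, k3, k4⟩, h4⟩
      refine ⟨q ++ p, by simp [hp], ?_, ?_, ?_, ?_⟩
      · unfold IsPath at *
        refine List.isChain_append.2 ⟨k1, h1, ?_⟩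
        intro x hx y hy
        rw [List.getLast?_eq_getLast_of_ne_nil hq] at hx
        rw [List.head?_eq_some_head hp] at hy
        simp only [Option.mem_def, Option.some.injEq] at hx hy
        subst hx hy
        exact k4
      · simp [h2, k2]
      · simpa [List.head_append_of_ne_nil, hq] using k3
      · simpa [List.getLast_append_of_ne_nil, hp] using h4

theorem aux_trans {V : Type u} {Ed : Type v} {L : Type w} (G : LabelledGraph V Ed L)
    {p q t : List L × Set V} (h : G.esLe p q) (h' : G.esLe q t) : G.esLe p t := by
  obtain ⟨γ, h1, h2⟩ := h
  obtain ⟨δ, k1, k2⟩ := h'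
  exact ⟨δ ++ γ, by rw [h1, k1, List.append_assoc],
    (h2.trans (G.aux_mono k2 γ)).trans (G.aux_append _ _ _)⟩

theorem aux_prefix_succ {L : Type w} (α : ℕ → L) (n : ℕ) :
    prefixN α (n + 1) = prefixN α n ++ [α n] := by
  simp [prefixN, seg, List.range_succ]

theorem aux_isWord {V : Type u} {Ed : Type v} {L : Type w} (G : LabelledGraph V Ed L)
    {α : ℕ → L} (hα : G.IsInfWord α) (n : ℕ) : G.IsWord (prefixN α n) := by
  obtain ⟨p, h1, h2⟩ := hα
  refine ⟨(List.range n).map p, ?_, ?_⟩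
  · unfold IsPath
    refine List.isChain_iff_getElem.2 ?_
    intro i hi
    simpa using h1 i
  · simp [prefixN, seg, Function.comp_def, h2]

/-- For an infinite word `α ∈ 𝓛^∞(E)` and an admissible family
`{F_n}` for `α`, the set `ξ = ⋃_{n} ⋃_{A ∈ F_n} ↑(α_{1,n}, A, α_{1,n})` is a filter
in `E(S)`. -/
theorem filter_from_admissible_family {V : Type u} {Ed : Type v} {L : Type w}
    [Nonempty V] [Countable V] [Nonempty Ed] [Countable Ed]
    (G : LabelledGraph V Ed L) (ℬ : Set (Set V))
    (hacc : G.Accommodating ℬ) (hwlr : G.WeaklyLeftResolving ℬ)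
    (α : ℕ → L) (hα : G.IsInfWord α)
    (F : ℕ → Set (Set V)) (hF : G.Admissible ℬ α F) :
    G.IsFilterES ℬ (G.filtOfFam ℬ α F) := by
  obtain ⟨⟨hpos, -⟩, hadm⟩ := hF
  have hrefl : ∀ p : List L × Set V, G.esLe p p := fun p =>
    ⟨[], by simp, subset_rfl⟩
  have hmem : ∀ n, 0 < n → ∀ A ∈ F n, (prefixN α n, A) ∈ G.filtOfFam ℬ α F := by
    intro n hn A hA
    obtain ⟨-, h2, h3, -⟩ := hpos n hn
    exact ⟨⟨G.aux_isWord hα n, h2 hA, fun h => h3 (h ▸ hA)⟩, n, A, hA, hrefl _⟩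
  have hpush : ∀ q n A, A ∈ F n → G.esLe (prefixN α n, A) q → ∀ k,
      ∃ B ∈ F (n + k), G.esLe (prefixN α (n + k), B) q := by
    intro q n A hA hle k
    induction k with
    | zero => exact ⟨A, hA, hle⟩
    | succ k ih =>
      obtain ⟨B, hB, hle'⟩ := ih
      refine ⟨_, (hadm _ hB).2, G.aux_trans ⟨[α (n + k)], ?_, subset_rfl⟩ hle'⟩
      exact aux_prefix_succ α (n + k)
  refine ⟨?_, fun p hp => hp.1, ?_, ?_⟩
  · obtain ⟨A, hA⟩ := (hpos 1 one_pos).1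
    exact ⟨_, hmem 1 one_pos A hA⟩
  · rintro p ⟨-, n, A, hA, hle⟩ q hq hpq
    exact ⟨hq, n, A, hA, G.aux_trans hle hpq⟩
  · rintro p ⟨-, n, A, hA, hp⟩ q ⟨-, m, B, hB, hq⟩
    obtain ⟨A', hA', hp'⟩ := hpush p n A hA hp (m + 1)
    obtain ⟨B', hB', hq'⟩ := hpush q m B hB hq (n + 1)
    have e : m + (n + 1) = n + (m + 1) := by omega
    rw [e] at hB' hq'
    obtain ⟨C, hC, hCA, hCB⟩ := (hpos (n + (m + 1)) (by omega)).2.2.2.2 A' hA' B' hB'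
    exact ⟨_, hmem _ (by omega) C hC,
      G.aux_trans (q := (_, A')) ⟨[], by simp, hCA⟩ hp',
      G.aux_trans (q := (_, B')) ⟨[], by simp, hCB⟩ hq'⟩

end LabelledGraph
end

section
/- Let (E, 𝓛, ℬ) be a weakly left resolving labelled space with associated inverse semigroup S. Let α, β ∈ 𝓛*(E) be such that αβ ∈ 𝓛*(E), let F be a filter in ℬ_α and G a filter in ℬ_{αβ}. Then the following are equivalent: (i) {r(A, β) : A ∈ F} ⊆ G; (ii) F ⊆ {A ∈ ℬ_α : r(A, β) ∈ G}; (iii) ⋃_{A ∈ F} ↑(α, A, α) ⊆ ⋃_{B ∈ G} ↑(αβ, B, αβ). -/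
universe u v w

attribute [local instance] Classical.propDecidable

namespace LabelledGraph

lemma relRange_mono_aux {V : Type u} {Ed : Type v} {L : Type w}
    (G : LabelledGraph V Ed L) {A B : Set V} (h : A ⊆ B) (α : List L) :
    G.relRange A α ⊆ G.relRange B α := by
  cases α with
  | nil => exact h
  | cons a w =>
    rintro v ⟨p, hp, h1, h2, h3, h4⟩
    exact ⟨p, hp, h1, h2, h h3, h4⟩

lemma mem_relRange_singleton_aux {V : Type u} {Ed : Type v} {L : Type w}
    (G : LabelledGraph V Ed L) (A : Set V) (a : L) (v : V) :
    v ∈ G.relRange A [a] ↔ ∃ e, G.lbl e = a ∧ G.src e ∈ A ∧ G.rng e = v := by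
  constructor
  · rintro ⟨p, hp, h1, h2, h3, h4⟩
    match p, hp, h2, h3, h4 with
    | [e], _, h2, h3, h4 => exact ⟨e, by simpa using h2, h3, h4⟩
    | e :: f :: l, _, h2, _, _ => simp at h2
  · rintro ⟨e, h1, h2, h3⟩
    exact ⟨[e], by simp, List.isChain_singleton e, by simp [h1], h2, h3⟩

lemma relRange_cons_aux {V : Type u} {Ed : Type v} {L : Type w}
    (G : LabelledGraph V Ed L) (A : Set V) (a : L) (w : List L) :
    G.relRange A (a :: w) = G.relRange (G.relRange A [a]) w := by
  cases w with
  | nil => rfl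
  | cons b w =>
    ext v
    constructor
    · rintro ⟨p, hp, h1, h2, h3, h4⟩
      match p, hp, h1, h2, h3, h4 with
      | [e], _, _, h2, _, _ => simp at h2
      | e :: f :: l, _, h1, h2, h3, h4 =>
        have h1' : G.rng e = G.src f ∧ G.IsPath (f :: l) := List.isChain_cons_cons.1 h1
        have h2' := List.cons.inj h2
        refine ⟨f :: l, by simp, h1'.2, h2'.2, ?_, ?_⟩
        · exact (G.mem_relRange_singleton_aux A a _).2 ⟨e, h2'.1, h3, h1'.1⟩
        · rw [← h4, List.getLast_cons (a := e) (l := f :: l) (by simp)]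
    · rintro ⟨p, hp, h1, h2, h3, h4⟩
      obtain ⟨e, e1, e2, e3⟩ := (G.mem_relRange_singleton_aux A a _).1 h3
      match p, hp, h1, h2, e3, h4 with
      | f :: l, hp, h1, h2, e3, h4 =>
        refine ⟨e :: f :: l, by simp, List.isChain_cons_cons.2 ⟨e3, h1⟩, ?_, e2, ?_⟩
        · rw [List.map_cons, e1, h2]
        · rw [← h4, List.getLast_cons]

lemma relRange_append_aux {V : Type u} {Ed : Type v} {L : Type w}
    (G : LabelledGraph V Ed L) (A : Set V) (α β : List L) :
    G.relRange A (α ++ β) = G.relRange (G.relRange A α) β := by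
  induction α generalizing A with
  | nil => rfl
  | cons a w ih =>
    rw [List.cons_append, relRange_cons_aux, ih, ← relRange_cons_aux]

lemma isWord_append_aux {V : Type u} {Ed : Type v} {L : Type w}
    (G : LabelledGraph V Ed L) {α β : List L} (h : G.IsWord (α ++ β)) :
    G.IsWord α ∧ G.IsWord β := by
  obtain ⟨p, h1, h2⟩ := h
  obtain ⟨p₁, p₂, rfl, h3, h4⟩ := List.map_eq_append_iff.1 h2
  exact ⟨⟨p₁, List.IsChain.left_of_append h1, h3⟩,
    ⟨p₂, List.IsChain.right_of_append h1, h4⟩⟩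

/-- For `α, β` with `αβ ∈ 𝓛*(E)`, a filter `F` in `ℬ_α` and a
filter `Gf` in `ℬ_{αβ}`, the following are equivalent:
(i) `{r(A, β) : A ∈ F} ⊆ Gf`;
(ii) `F ⊆ {A ∈ ℬ_α : r(A, β) ∈ Gf}`;
(iii) `⋃_{A ∈ F} ↑(α, A, α) ⊆ ⋃_{B ∈ Gf} ↑(αβ, B, αβ)`. -/
theorem filters_relRange_tfae {V : Type u} {Ed : Type v} {L : Type w}
    [Nonempty V] [Countable V] [Nonempty Ed] [Countable Ed]
    (G : LabelledGraph V Ed L) (ℬ : Set (Set V))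
    (hacc : G.Accommodating ℬ) (hwlr : G.WeaklyLeftResolving ℬ)
    (α β : List L) (hαβ : G.IsWord (α ++ β))
    (F : Set (Set V)) (hF : IsFilterIn (G.rFam ℬ α) F)
    (Gf : Set (Set V)) (hGf : IsFilterIn (G.rFam ℬ (α ++ β)) Gf) :
    ((∀ A ∈ F, G.relRange A β ∈ Gf) ↔
      F ⊆ {A ∈ G.rFam ℬ α | G.relRange A β ∈ Gf}) ∧
    (F ⊆ {A ∈ G.rFam ℬ α | G.relRange A β ∈ Gf} ↔
      {q : List L × Set V | G.ValidE ℬ q ∧ ∃ A ∈ F, G.esLe (α, A) q} ⊆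
        {q : List L × Set V | G.ValidE ℬ q ∧ ∃ B ∈ Gf, G.esLe (α ++ β, B) q}) := by
  refine ⟨⟨fun h A hA => ⟨hF.2.1 hA, h A hA⟩, fun h A hA => (h hA).2⟩, ?_, ?_⟩
  · rintro h q ⟨hq, A, hA, γ, h1, h2⟩
    refine ⟨hq, G.relRange A β, (h hA).2, γ ++ β, ?_, ?_⟩
    · change α = q.1 ++ γ at h1
      change α ++ β = q.1 ++ (γ ++ β)
      rw [h1, List.append_assoc]
    · rw [relRange_append_aux]
      exact G.relRange_mono_aux h2 β
  · intro h A hA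
    have hAα := hF.2.1 hA
    have hw := G.isWord_append_aux hαβ
    refine ⟨hAα, ?_⟩
    have hne : A ≠ ∅ := fun he => hF.2.2.1 (he ▸ hA)
    obtain ⟨-, B, hB, γ, h1, h2⟩ := @h (α, A)
      ⟨⟨hw.1, hAα, hne⟩, A, hA, [], (List.append_nil α).symm, subset_rfl⟩
    obtain rfl : β = γ := List.append_cancel_left h1
    refine hGf.2.2.2.1 B hB _ ⟨hacc.1 A hAα.1 β hw.2, ?_⟩ h2
    rw [range, relRange_append_aux]
    exact G.relRange_mono_aux hAα.2 β

end LabelledGraph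
end

section
/- Let (E, 𝓛, ℬ) be a weakly left resolving labelled space with associated inverse semigroup S, and let α ∈ 𝓛^∞(E) and {F_n}_{n≥0} be a family with F_n a filter in ℬ_{α_{1,n}} for every n > 0 and F_0 a filter in ℬ or empty. Then {F_n}_{n≥0} is a complete family for α if and only if F_n = {A ∈ ℬ_{α_{1,n}} : r(A, α_{n+1,m}) ∈ F_m} for all n ≥ 0 and all m > n. -/
universe u v w

attribute [local instance] Classical.propDecidable

namespace LabelledGraph

theorem mem_relRange_cons {V : Type u} {Ed : Type v} {L : Type w}
    (G : LabelledGraph V Ed L) (A : Set V) (a : L) (w : List L) (v : V) :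
    v ∈ G.relRange A (a :: w) ↔
      ∃ e, G.lbl e = a ∧ G.src e ∈ A ∧ v ∈ G.relRange {G.rng e} w := by
  constructor
  · rintro ⟨p, h, hp, hm, hs, hr⟩
    cases p with
    | nil => exact absurd rfl h
    | cons e q =>
      simp only [List.map_cons, List.cons.injEq] at hm
      refine ⟨e, hm.1, hs, ?_⟩
      obtain ⟨-, rfl⟩ := hm
      cases q with
      | nil => simpa [relRange] using hr.symm
      | cons f q =>
        have hp' := List.isChain_cons_cons.mp hp
        exact ⟨f :: q, by simp, hp'.2, rfl, hp'.1.symm, by simpa using hr⟩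
  · rintro ⟨e, rfl, hs, hv⟩
    cases w with
    | nil =>
      exact ⟨[e], by simp, List.isChain_singleton e, rfl, hs, hv.symm⟩
    | cons b w =>
      obtain ⟨p, h, hp, hm, hs', hr⟩ := hv
      cases p with
      | nil => exact absurd rfl h
      | cons f q =>
        exact ⟨e :: f :: q, by simp, List.isChain_cons_cons.mpr ⟨hs'.symm, hp⟩,
          by rw [List.map_cons, hm], hs, by simpa using hr⟩

theorem mem_relRange_iff {V : Type u} {Ed : Type v} {L : Type w}
    (G : LabelledGraph V Ed L) (A : Set V) (w : List L) (v : V) :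
    v ∈ G.relRange A w ↔ ∃ x ∈ A, v ∈ G.relRange {x} w := by
  cases w with
  | nil => simp [relRange]
  | cons a w =>
    simp only [mem_relRange_cons, Set.mem_singleton_iff]
    constructor
    · rintro ⟨e, h1, h2, h3⟩
      exact ⟨_, h2, e, h1, rfl, h3⟩
    · rintro ⟨x, hx, e, h1, rfl, h3⟩
      exact ⟨e, h1, hx, h3⟩

theorem relRange_mono' {V : Type u} {Ed : Type v} {L : Type w}
    (G : LabelledGraph V Ed L) {A B : Set V} (h : A ⊆ B) (w : List L) :
    G.relRange A w ⊆ G.relRange B w := by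
  intro v hv
  rw [mem_relRange_iff] at hv ⊢
  obtain ⟨x, hx, hv⟩ := hv
  exact ⟨x, h hx, hv⟩

theorem relRange_append' {V : Type u} {Ed : Type v} {L : Type w}
    (G : LabelledGraph V Ed L) (A : Set V) (w w' : List L) :
    G.relRange A (w ++ w') = G.relRange (G.relRange A w) w' := by
  induction w generalizing A with
  | nil => rfl
  | cons a w ih =>
    ext v
    rw [List.cons_append, mem_relRange_cons, mem_relRange_iff]
    simp only [mem_relRange_cons, ih]
    constructor
    · rintro ⟨e, h1, h2, h3⟩
      rw [mem_relRange_iff] at h3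
      obtain ⟨x, hx, h3⟩ := h3
      exact ⟨x, ⟨e, h1, h2, hx⟩, h3⟩
    · rintro ⟨x, ⟨e, h1, h2, hx⟩, h3⟩
      refine ⟨e, h1, h2, ?_⟩
      rw [mem_relRange_iff]
      exact ⟨x, hx, h3⟩

theorem seg_append' {L : Type w} (α : ℕ → L) {k n m : ℕ} (h1 : k ≤ n) (h2 : n ≤ m) :
    seg α k n ++ seg α n m = seg α k m := by
  obtain ⟨a, rfl⟩ := Nat.exists_eq_add_of_le h1
  obtain ⟨b, rfl⟩ := Nat.exists_eq_add_of_le h2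
  have e1 : k + a - k = a := by omega
  have e2 : k + a + b - (k + a) = b := by omega
  have e3 : k + a + b - k = a + b := by omega
  simp only [seg, e1, e2, e3, List.range_add, List.map_append, List.map_map]
  congr 1
  apply List.map_congr_left
  intro i _
  simp [Nat.add_assoc]

theorem seg_succ' {L : Type w} (α : ℕ → L) (n : ℕ) : seg α n (n + 1) = [α n] := by
  simp [seg]

theorem isWord_seg' {V : Type u} {Ed : Type v} {L : Type w}
    (G : LabelledGraph V Ed L) (α : ℕ → L) (hα : G.IsInfWord α) (n m : ℕ) :
    G.IsWord (seg α n m) := by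
  obtain ⟨p, hp, hl⟩ := hα
  refine ⟨(List.range (m - n)).map fun i => p (n + i), ?_, ?_⟩
  · unfold IsPath
    refine List.isChain_iff_getElem.mpr ?_
    intro i hi
    simp only [List.getElem_map, List.getElem_range]
    exact hp (n + i)
  · simp [seg, hl]

/-- A family `{F_n}` (with `F_n` a filter in `ℬ_{α_{1,n}}` for
`n > 0` and `F_0` a filter in `ℬ` or empty) is complete for `α ∈ 𝓛^∞(E)` iff
`F_n = {A ∈ ℬ_{α_{1,n}} : r(A, α_{n+1,m}) ∈ F_m}` for all `n ≥ 0` and `m > n`. -/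
theorem complete_family_iff_multi_step {V : Type u} {Ed : Type v} {L : Type w}
    [Nonempty V] [Countable V] [Nonempty Ed] [Countable Ed]
    (G : LabelledGraph V Ed L) (ℬ : Set (Set V))
    (hacc : G.Accommodating ℬ) (hwlr : G.WeaklyLeftResolving ℬ)
    (α : ℕ → L) (hα : G.IsInfWord α)
    (F : ℕ → Set (Set V)) (hfam : G.IsFam ℬ α F) :
    G.Complete ℬ α F ↔
      ∀ n m, n < m →
        F n = {A ∈ G.rFam ℬ (prefixN α n) | G.relRange A (seg α n m) ∈ F m} := by
  constructor
  · rintro ⟨-, hc⟩ n m hnm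
    induction m, hnm using Nat.le_induction with
    | base =>
      rw [Nat.succ_eq_add_one, seg_succ']
      exact hc n
    | succ m hnm ih =>
      rw [ih]
      ext A
      refine and_congr_right fun hA => ?_
      have hnm' : n ≤ m := by omega
      have hmem : G.relRange A (seg α n m) ∈ G.rFam ℬ (prefixN α m) := by
        refine ⟨hacc.1 A hA.1 _ (isWord_seg' G α hα n m), ?_⟩
        have := relRange_mono' G hA.2 (seg α n m)
        rwa [range, ← relRange_append', prefixN, seg_append' α (Nat.zero_le n) hnm'] at this
      rw [← seg_append' α hnm' (Nat.le_succ m), seg_succ', relRange_append']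
      have h := Set.ext_iff.mp (hc m) (G.relRange A (seg α n m))
      exact h.trans (and_iff_right hmem)
  · intro h
    refine ⟨hfam, fun n => ?_⟩
    have := h n (n + 1) (Nat.lt_succ_self n)
    rwa [seg_succ'] at this

end LabelledGraph
end
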